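/- arXiv:2301.02616 — 2 statements merged into one kernel-verified Lean document; each statement's English description precedes it below -/
import Mathlib

section
/- Let n be odd, and let p_0, ..., p_n be points in n-dimensional Euclidean space ℝ^n with ‖p_i − p_j‖ = 1 for all i ≠ j (the vertex set of a regular n-simplex Δ_n of side length 1). Then the width of their convex hull, defined as the infimum over all unit vectors u ∈ ℝ^n of (max_i ⟨u, p_i⟩ − min_i ⟨u, p_i⟩), equals √(2/(n+1)). -/
open RealInnerProductSpace

/-- Inner products of centred points at pairwise unit distance. -/
lemma inner_of_dist_eq_one_of_sum_eq_zero {E : Type*} [NormedAddCommGroup E]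
    [InnerProductSpace ℝ E] {n : ℕ} (q : Fin (n + 1) → E)
    (hq : ∀ i j, i ≠ j → dist (q i) (q j) = 1) (hsum : ∑ i, q i = 0) (i j : Fin (n + 1)) :
    ⟪q i, q j⟫ = (if i = j then (1 / 2 : ℝ) else 0) - 1 / (2 * ((n : ℝ) + 1)) := by
  have hm : (n : ℝ) + 1 ≠ 0 := by positivity
  have hd : ∀ i j, ‖q i‖ ^ 2 - 2 * ⟪q i, q j⟫ + ‖q j‖ ^ 2 = 1 - if i = j then (1 : ℝ) else 0 := by
    intro i j
    rw [← norm_sub_sq_real, ← dist_eq_norm]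
    split_ifs with h
    · simp [h]
    · simp [hq i j h]
  have hs : ∀ i, ((n : ℝ) + 1) * ‖q i‖ ^ 2 + ∑ j, ‖q j‖ ^ 2 = n := by
    intro i
    have h := Finset.sum_congr (rfl : (Finset.univ : Finset (Fin (n + 1))) = _)
      fun j _ => hd i j
    simpa [Finset.sum_add_distrib, Finset.sum_sub_distrib, ← Finset.mul_sum, ← inner_sum, hsum]
      using h
  have ht : ((n : ℝ) + 1) * ∑ j, ‖q j‖ ^ 2 + ((n : ℝ) + 1) * ∑ j, ‖q j‖ ^ 2 = (n + 1) * n := by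
    have h := Finset.sum_congr (rfl : (Finset.univ : Finset (Fin (n + 1))) = _) fun j _ => hs j
    simpa [Finset.sum_add_distrib, ← Finset.mul_sum] using h
  have ha : ∀ i, ‖q i‖ ^ 2 = 1 / 2 - 1 / (2 * ((n : ℝ) + 1)) := by
    intro i
    have h2 : 2 * ∑ j, ‖q j‖ ^ 2 = (n : ℝ) := mul_left_cancel₀ hm (by linarith)
    have := hs i
    field_simp
    linarith
  have h := hd i j
  rw [ha, ha] at h
  split_ifs at h ⊢ <;> linarith

/-- The vertices of a centred regular simplex of side length 1 form a tight frame. -/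
lemma sum_sq_inner_of_dist_eq_one_of_sum_eq_zero {n : ℕ}
    (q : Fin (n + 1) → EuclideanSpace ℝ (Fin n))
    (hq : ∀ i j, i ≠ j → dist (q i) (q j) = 1) (hsum : ∑ i, q i = 0)
    (u : EuclideanSpace ℝ (Fin n)) :
    ∑ i, ⟪u, q i⟫ ^ 2 = ‖u‖ ^ 2 / 2 := by
  have hm : (0 : ℝ) < (n : ℝ) + 1 := by positivity
  let b : Fin (n + 1) → WithLp 2 (EuclideanSpace ℝ (Fin n) × ℝ) := fun i =>
    WithLp.toLp 2 (√2 • q i, √(1 / ((n : ℝ) + 1)))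
  have hb : Orthonormal ℝ b := by
    rw [orthonormal_iff_ite]
    intro i j
    simp only [b, WithLp.prod_inner_apply, inner_smul_left, inner_smul_right,
      inner_of_dist_eq_one_of_sum_eq_zero q hq hsum]
    have h2 : √2 * √2 = (2 : ℝ) := Real.mul_self_sqrt (by norm_num)
    have h1 := Real.mul_self_sqrt (show (0 : ℝ) ≤ 1 / ((n : ℝ) + 1) by positivity)
    simp only [conj_trivial, ← mul_assoc, h2, RCLike.inner_apply, h1]
    split_ifs <;> field_simp <;> ring
  have hcard : Fintype.card (Fin (n + 1)) =
      Module.finrank ℝ (WithLp 2 (EuclideanSpace ℝ (Fin n) × ℝ)) := by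
    rw [(WithLp.linearEquiv 2 ℝ (EuclideanSpace ℝ (Fin n) × ℝ)).finrank_eq]
    simp
  let B := (basisOfOrthonormalOfCardEqFinrank hb hcard).toOrthonormalBasis (by simpa using hb)
  have hB : ∀ i, B i = b i := fun i => by simp [B]
  have h := B.sum_sq_norm_inner_left (WithLp.toLp 2 (u, (0 : ℝ)))
  simp only [hB, b, WithLp.prod_inner_apply, inner_smul_right, WithLp.prod_norm_sq_eq_of_L2,
    inner_zero_left, add_zero, Real.norm_eq_abs, sq_abs, mul_pow,
    Real.sq_sqrt (show (0 : ℝ) ≤ 2 by norm_num), ← Finset.mul_sum] at h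
  norm_num at h
  linarith

/-- For odd `n`, the width of the regular `n`-simplex of side length 1 in `ℝ^n`
(the convex hull of `n+1` pairwise unit-distance points), i.e. the infimum over
unit directions `u` of `max_i ⟨u, p_i⟩ - min_i ⟨u, p_i⟩`, equals `√(2/(n+1))`. -/
theorem width_regular_simplex_odd (n : ℕ) (hn : Odd n)
    (p : Fin (n + 1) → EuclideanSpace ℝ (Fin n))
    (hp : ∀ i j, i ≠ j → dist (p i) (p j) = 1) :
    sInf ((fun u : EuclideanSpace ℝ (Fin n) =>
          Finset.univ.sup' Finset.univ_nonempty (fun i => ⟪u, p i⟫) -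
            Finset.univ.inf' Finset.univ_nonempty (fun i => ⟪u, p i⟫)) ''
        {u | ‖u‖ = 1}) =
      Real.sqrt (2 / ((n : ℝ) + 1)) := by
  have hm : (0 : ℝ) < (n : ℝ) + 1 := by positivity
  obtain ⟨c, hc⟩ : ∃ c, ∑ i, (p i - c) = 0 := by
    refine ⟨((n : ℝ) + 1)⁻¹ • ∑ i, p i, ?_⟩
    rw [Finset.sum_sub_distrib, Finset.sum_const, Finset.card_univ, Fintype.card_fin,
      ← Nat.cast_smul_eq_nsmul ℝ, smul_smul]
    push_cast
    rw [mul_inv_cancel₀ hm.ne', one_smul, sub_self]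
  have hq : ∀ i j, i ≠ j → dist (p i - c) (p j - c) = 1 := by simpa using hp
  have hinner := inner_of_dist_eq_one_of_sum_eq_zero _ hq hc
  apply IsLeast.csInf_eq
  constructor
  · let ε : Fin (n + 1) → ℝ := fun i => (-1) ^ (i : ℕ)
    have hε : ∑ i, ε i = 0 := by
      simp only [ε]
      rw [Fin.sum_univ_eq_sum_range (fun i => (-1 : ℝ) ^ i), neg_one_geom_sum,
        if_pos hn.add_one]
    have hεsq : ∀ i, ε i * ε i = 1 := fun i => by simp [ε, ← mul_pow]
    set s := √(2 / ((n : ℝ) + 1)) with hs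
    have hs0 : 0 ≤ s := Real.sqrt_nonneg _
    have hssq : s * s = 2 / ((n : ℝ) + 1) := Real.mul_self_sqrt (by positivity)
    let u : EuclideanSpace ℝ (Fin n) := s • ∑ i, ε i • (p i - c)
    have huq : ∀ j, ⟪u, p j - c⟫ = s * (ε j / 2) := by
      intro j
      simp only [u, inner_smul_left, sum_inner, hinner, conj_trivial, mul_sub,
        Finset.sum_sub_distrib, ← Finset.sum_mul, hε]
      simp [div_eq_mul_inv]
    have hu : ‖u‖ = 1 := by
      have h : ‖u‖ ^ 2 = 1 := by
        rw [← real_inner_self_eq_norm_sq]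
        nth_rewrite 2 [show u = s • ∑ i, ε i • (p i - c) from rfl]
        simp only [inner_smul_right, inner_sum, huq]
        have : ∀ i, ε i * (s * (ε i / 2)) = s / 2 := fun i => by
          linear_combination s / 2 * hεsq i
        simp only [this, Finset.sum_const, Finset.card_univ, Fintype.card_fin, nsmul_eq_mul]
        push_cast
        field_simp at hssq
        linarith
      exact (sq_eq_sq₀ (norm_nonneg _) zero_le_one).1 (by simpa using h)
    have hup : ∀ j, ⟪u, p j⟫ = s * (ε j / 2) + ⟪u, c⟫ := fun j => by
      rw [← huq, ← inner_add_right, sub_add_cancel]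
    have habs : ∀ j, ε j ≤ 1 ∧ -1 ≤ ε j := fun j =>
      ⟨by nlinarith [hεsq j], by nlinarith [hεsq j]⟩
    refine ⟨u, hu, ?_⟩
    have h1 : Finset.univ.sup' Finset.univ_nonempty (fun i => ⟪u, p i⟫) = s / 2 + ⟪u, c⟫ := by
      apply le_antisymm
      · refine Finset.sup'_le _ _ fun i _ => ?_
        rw [hup]
        nlinarith [habs i]
      · refine Finset.le_sup'_of_le _ (Finset.mem_univ 0) ?_
        simp [hup, ε, div_eq_mul_inv]
    have h2 : Finset.univ.inf' Finset.univ_nonempty (fun i => ⟪u, p i⟫) = -(s / 2) + ⟪u, c⟫ := by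
      apply le_antisymm
      · refine Finset.inf'_le_of_le _ (Finset.mem_univ (Fin.last n)) ?_
        rw [hup]
        simp only [ε, Fin.val_last, hn.neg_one_pow]
        linarith
      · refine Finset.le_inf' _ _ fun i _ => ?_
        rw [hup]
        nlinarith [habs i]
    change _ - _ = _
    rw [h1, h2]
    ring
  · rintro _ ⟨u, hu, rfl⟩
    have hu : ‖u‖ = 1 := hu
    change _ ≤ _ - _
    set M := Finset.univ.sup' Finset.univ_nonempty (fun i => ⟪u, p i⟫)
    set m := Finset.univ.inf' Finset.univ_nonempty (fun i => ⟪u, p i⟫)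
    have hM : ∀ i, ⟪u, p i⟫ ≤ M := fun i =>
      Finset.le_sup' (fun i => ⟪u, p i⟫) (Finset.mem_univ i)
    have hmin : ∀ i, m ≤ ⟪u, p i⟫ := fun i =>
      Finset.inf'_le (fun i => ⟪u, p i⟫) (Finset.mem_univ i)
    refine Real.sqrt_le_iff.2 ⟨by linarith [hM 0, hmin 0], ?_⟩
    have hframe := sum_sq_inner_of_dist_eq_one_of_sum_eq_zero _ hq hc u
    have hzero : ∑ i, ⟪u, p i - c⟫ = 0 := by rw [← inner_sum, hc, inner_zero_right]
    have hle : ∑ i, (⟪u, p i - c⟫ ^ 2 + (2 * ⟪u, c⟫ - (M + m)) * ⟪u, p i - c⟫) ≤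
        ∑ _i : Fin (n + 1), (M - m) ^ 2 / 4 := by
      refine Finset.sum_le_sum fun i _ => ?_
      have h1 := hM i
      have h2 := hmin i
      rw [inner_sub_right]
      nlinarith [mul_nonneg (sub_nonneg.2 h1) (sub_nonneg.2 h2),
        sq_nonneg (⟪u, c⟫ - (M + m) / 2)]
    rw [Finset.sum_add_distrib, ← Finset.mul_sum, hzero, hframe, hu] at hle
    simp only [Finset.sum_const, Finset.card_univ, Fintype.card_fin, nsmul_eq_mul] at hle
    push_cast at hle
    rw [div_le_iff₀ hm]
    linarith
end

section
/- Let n ≥ 2 be even, and let p_0, ..., p_n be points in n-dimensional Euclidean space ℝ^n with ‖p_i − p_j‖ = 1 for all i ≠ j (the vertex set of a regular n-simplex Δ_n of side length 1). Then the width of their convex hull, defined as the infimum over all unit vectors u ∈ ℝ^n of (max_i ⟨u, p_i⟩ − min_i ⟨u, p_i⟩), equals √(2(n+1)/(n(n+2))). -/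
open RealInnerProductSpace

section UnitSimplex

variable {ι E : Type*} [Fintype ι] [NormedAddCommGroup E] [InnerProductSpace ℝ E]

/-- Zero-sum combinations of points at pairwise distance one have the standard inner product of
their coefficients, up to a factor `1 / 2`. -/
lemma inner_sum_smul_of_dist_eq_one {p : ι → E} (hp : ∀ i j, i ≠ j → dist (p i) (p j) = 1)
    {b c : ι → ℝ} (hb : ∑ i, b i = 0) (hc : ∑ i, c i = 0) :
    ⟪∑ i, b i • p i, ∑ i, c i • p i⟫ = (∑ i, b i * c i) / 2 := by
  classical
  have gram (i j : ι) :
      ⟪p i, p j⟫ = (‖p i‖ ^ 2 + ‖p j‖ ^ 2 - 1 + if i = j then 1 else 0) / 2 := by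
    split_ifs with h
    · subst h
      rw [real_inner_self_eq_norm_sq]
      ring
    · have h1 := hp i j h
      have h2 := norm_sub_sq_real (p i) (p j)
      rw [← dist_eq_norm, h1] at h2
      linarith
  have expand (i j : ι) : c j * (b i * ⟪p i, p j⟫) =
      c j * (b i * ‖p i‖ ^ 2 / 2) + c j * (‖p j‖ ^ 2 - 1) / 2 * b i
        + if i = j then b i * c j / 2 else 0 := by
    rw [gram]
    split_ifs <;> ring
  simp only [sum_inner, inner_sum, real_inner_smul_left, real_inner_smul_right]
  simp only [expand, Finset.sum_add_distrib, Finset.sum_ite_eq', Finset.mem_univ, if_true]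
  simp only [← Finset.mul_sum, ← Finset.sum_mul, ← Finset.sum_div, hb, hc]
  simp

lemma inner_sum_smul_sub_of_dist_eq_one {p : ι → E} (hp : ∀ i j, i ≠ j → dist (p i) (p j) = 1)
    {b : ι → ℝ} (hb : ∑ i, b i = 0) (j k : ι) :
    ⟪∑ i, b i • p i, p j⟫ - ⟪∑ i, b i • p i, p k⟫ = (b j - b k) / 2 := by
  classical
  have h := inner_sum_smul_of_dist_eq_one hp hb
    (c := fun i => (if i = j then 1 else 0) - (if i = k then 1 else 0)) (by simp)
  simpa [sub_smul, mul_sub, inner_sub_right] using h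

lemma norm_sq_sum_smul_of_dist_eq_one {p : ι → E} (hp : ∀ i j, i ≠ j → dist (p i) (p j) = 1)
    {b : ι → ℝ} (hb : ∑ i, b i = 0) :
    ‖∑ i, b i • p i‖ ^ 2 = (∑ i, b i ^ 2) / 2 := by
  rw [← real_inner_self_eq_norm_sq, inner_sum_smul_of_dist_eq_one hp hb hb]
  simp only [sq]

/-- The `n + 1` vertices of a regular simplex in dimension `n` represent every vector as a
zero-sum combination. -/
lemma exists_sum_smul_eq_of_dist_eq_one {n : ℕ} [FiniteDimensional ℝ E]
    (hE : Module.finrank ℝ E = n) {p : Fin (n + 1) → E}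
    (hp : ∀ i j, i ≠ j → dist (p i) (p j) = 1) (u : E) :
    ∃ b : Fin (n + 1) → ℝ, ∑ i, b i = 0 ∧ ∑ i, b i • p i = u := by
  let f := Fintype.linearCombination ℝ (fun i : Fin n => p i.succ - p 0)
  let ext (a : Fin n → ℝ) : Fin (n + 1) → ℝ := Fin.cons (-∑ i, a i) a
  have ext_sum (a) : ∑ i, ext a i = 0 := by simp [ext, Fin.sum_univ_succ]
  have ext_smul (a) : ∑ i, ext a i • p i = f a := by
    simp [ext, f, Fin.sum_univ_succ, Fintype.linearCombination_apply, smul_sub, Finset.sum_smul]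
    abel
  have hinj : Function.Injective f := by
    rw [← LinearMap.ker_eq_bot, LinearMap.ker_eq_bot']
    intro a ha
    have h := norm_sq_sum_smul_of_dist_eq_one hp (ext_sum a)
    rw [ext_smul, ha, norm_zero] at h
    have h0 : ∑ i, ext a i ^ 2 = 0 := by linarith
    rw [Finset.sum_eq_zero_iff_of_nonneg fun _ _ => sq_nonneg _] at h0
    funext i
    simpa [ext] using h0 i.succ (Finset.mem_univ _)
  obtain ⟨a, rfl⟩ := (LinearMap.injective_iff_surjective_of_finrank_eq_finrank
    (by simp [hE])).1 hinj u
  exact ⟨ext a, ext_sum a, ext_smul a⟩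

lemma convexOn_card_mul_sum_sq_sub_sq_sum :
    ConvexOn ℝ Set.univ
      (fun b : ι → ℝ => (Fintype.card ι : ℝ) * ∑ i, b i ^ 2 - (∑ i, b i) ^ 2) := by
  refine ⟨convex_univ, fun x _ y _ s t hs ht hst => ?_⟩
  have cs := sq_sum_le_card_mul_sum_sq (s := (Finset.univ : Finset ι)) (f := fun i => x i - y i)
  have hsq : ∑ i, (s * x i + t * y i) ^ 2 =
      s * ∑ i, x i ^ 2 + t * ∑ i, y i ^ 2 - s * t * ∑ i, (x i - y i) ^ 2 := by
    simp only [Finset.mul_sum, ← Finset.sum_add_distrib, ← Finset.sum_sub_distrib]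
    refine Finset.sum_congr rfl fun i _ => ?_
    obtain rfl : t = 1 - s := by linarith
    ring
  have hsum : ∑ i, (s * x i + t * y i) = s * ∑ i, x i + t * ∑ i, y i := by
    simp only [Finset.mul_sum, ← Finset.sum_add_distrib]
  simp only [Pi.add_apply, Pi.smul_apply, smul_eq_mul, hsq, hsum]
  rw [Finset.sum_sub_distrib, Finset.card_univ] at cs
  have := mul_le_mul_of_nonneg_left cs (mul_nonneg hs ht)
  obtain rfl : t = 1 - s := by linarith
  linarith

/-- Popoviciu's variance inequality, sharpened for an odd number of values. -/
lemma card_mul_sum_sq_sub_sq_sum_le {m : ℕ} (hι : Fintype.card ι = 2 * m + 1) {l h : ℝ}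
    (hlh : l ≤ h) {b : ι → ℝ} (hb : ∀ i, b i ∈ Set.Icc l h) :
    (Fintype.card ι : ℝ) * ∑ i, b i ^ 2 - (∑ i, b i) ^ 2 ≤ m * (m + 1) * (h - l) ^ 2 := by
  classical
  have hmem : b ∈ convexHull ℝ (Set.univ.pi fun _ : ι => ({l, h} : Set ℝ)) := by
    rw [convexHull_pi]
    intro i _
    rw [convexHull_pair, segment_eq_Icc hlh]
    exact hb i
  obtain ⟨v, hv, hle⟩ := (convexOn_card_mul_sum_sq_sub_sq_sum (ι := ι)).exists_ge_of_mem_convexHull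
    (Set.subset_univ _) hmem
  refine hle.trans ?_
  let S := Finset.univ.filter fun i => v i = h
  have hv' : v = fun i => l + if i ∈ S then h - l else 0 := by
    funext i
    by_cases hi : v i = h
    · simp [S, hi]
    · have := hv i trivial
      simp_all [S]
  have sum1 : ∑ i, v i = (2 * m + 1) * l + S.card * (h - l) := by
    rw [hv']
    simp [Finset.sum_add_distrib, hι, mul_sub]
  have sum2 : ∑ i, v i ^ 2 = (2 * m + 1) * l ^ 2 + S.card * (h ^ 2 - l ^ 2) := by
    have : ∀ i, v i ^ 2 = l ^ 2 + if i ∈ S then h ^ 2 - l ^ 2 else 0 := by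
      intro i
      rw [hv']
      dsimp only
      split_ifs <;> ring
    simp [this, Finset.sum_add_distrib, hι, mul_sub]
  have hint : 0 ≤ ((S.card : ℝ) - m) * (S.card - m - 1) := by
    rcases le_or_gt S.card m with hk | hk
    · have : (S.card : ℝ) ≤ m := by exact_mod_cast hk
      nlinarith
    · have : (m : ℝ) + 1 ≤ S.card := by exact_mod_cast hk
      nlinarith
  have := mul_nonneg hint (sq_nonneg (h - l))
  simp only [sum1, sum2, hι]
  push_cast
  linarith

end UnitSimplex

/-- For even `n ≥ 2`, the width of the regular `n`-simplex of side length 1 in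
`ℝ^n` (the convex hull of `n+1` pairwise unit-distance points), i.e. the infimum
over unit directions `u` of `max_i ⟨u, p_i⟩ - min_i ⟨u, p_i⟩`, equals
`√(2(n+1)/(n(n+2)))`. -/
theorem width_regular_simplex_even (n : ℕ) (hn : Even n) (hn2 : 2 ≤ n)
    (p : Fin (n + 1) → EuclideanSpace ℝ (Fin n))
    (hp : ∀ i j, i ≠ j → dist (p i) (p j) = 1) :
    sInf ((fun u : EuclideanSpace ℝ (Fin n) =>
          Finset.univ.sup' Finset.univ_nonempty (fun i => ⟪u, p i⟫) -
            Finset.univ.inf' Finset.univ_nonempty (fun i => ⟪u, p i⟫)) ''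
        {u | ‖u‖ = 1}) =
      Real.sqrt (2 * ((n : ℝ) + 1) / ((n : ℝ) * ((n : ℝ) + 2))) := by
  obtain ⟨m, hm⟩ := hn
  have hnm : (n : ℝ) = 2 * m := by
    rw [hm]
    push_cast
    ring
  have hm0 : (0 : ℝ) < m := by
    have : 0 < m := by omega
    exact_mod_cast this
  have lower : ∀ u : EuclideanSpace ℝ (Fin n), ‖u‖ = 1 →
      Real.sqrt (2 * ((n : ℝ) + 1) / ((n : ℝ) * ((n : ℝ) + 2))) ≤
        Finset.univ.sup' Finset.univ_nonempty (fun i => ⟪u, p i⟫) -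
          Finset.univ.inf' Finset.univ_nonempty (fun i => ⟪u, p i⟫) := by
    intro u hu
    obtain ⟨i, -, hi⟩ := Finset.exists_mem_eq_sup' Finset.univ_nonempty (fun i => ⟪u, p i⟫)
    obtain ⟨j, -, hj⟩ := Finset.exists_mem_eq_inf' Finset.univ_nonempty (fun i => ⟪u, p i⟫)
    have hmax : ∀ k, ⟪u, p k⟫ ≤ ⟪u, p i⟫ := fun k =>
      hi ▸ Finset.le_sup' (fun i => ⟪u, p i⟫) (Finset.mem_univ k)
    have hmin : ∀ k, ⟪u, p j⟫ ≤ ⟪u, p k⟫ := fun k =>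
      hj ▸ Finset.inf'_le (fun i => ⟪u, p i⟫) (Finset.mem_univ k)
    rw [hi, hj]
    obtain ⟨b, hb, rfl⟩ := exists_sum_smul_eq_of_dist_eq_one (by simp) hp u
    have hnorm := norm_sq_sum_smul_of_dist_eq_one hp hb
    have hdiff := inner_sum_smul_sub_of_dist_eq_one hp hb
    have hbound := card_mul_sum_sq_sub_sq_sum_le (m := m) (l := b j) (h := b i) (b := b)
      (by simp; omega) (by linarith [hdiff i j, hmax j]) fun k =>
        ⟨by linarith [hdiff k j, hmin k], by linarith [hdiff i k, hmax k]⟩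
    have hij := hmax j
    have hsq : ∑ k, b k ^ 2 = 2 := by
      rw [hu] at hnorm
      linarith
    rw [hsq, hb] at hbound
    have hd := hdiff i j
    apply Real.sqrt_le_iff.2 ⟨by linarith, ?_⟩
    rw [hd, div_le_iff₀ (by rw [hnm]; positivity), hnm]
    simp only [Fintype.card_fin] at hbound
    push_cast at hbound
    rw [hnm] at hbound
    nlinarith
  let r : ℝ := Real.sqrt (2 / (m * (m + 1) * (2 * m + 1)))
  have hr : r ^ 2 = 2 / (m * (m + 1) * (2 * m + 1)) := Real.sq_sqrt (by positivity)
  have hr0 : 0 ≤ r := Real.sqrt_nonneg _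
  let b : Fin (n + 1) → ℝ := fun i => -r * m + if (i : ℕ) < m then r * (2 * m + 1) else 0
  have hcard : (Finset.univ.filter fun i : Fin (n + 1) => (i : ℕ) < m).card = m := by
    rw [Fin.card_filter_val_lt]
    omega
  have hb : ∑ i, b i = 0 := by
    simp only [b, Finset.sum_add_distrib, ← Finset.sum_filter, Finset.sum_const, hcard]
    simp [hnm]
    ring
  have hbsq : ∑ i, b i ^ 2 = 2 := by
    have hsq : ∀ i, b i ^ 2 = r ^ 2 * m ^ 2 +
        if (i : ℕ) < m then r ^ 2 * (2 * m + 1) else 0 := by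
      intro i
      dsimp only [b]
      split_ifs <;> ring
    simp only [hsq, Finset.sum_add_distrib, ← Finset.sum_filter, Finset.sum_const, hcard, hr]
    simp [hnm]
    field_simp
  have hu : ‖∑ i, b i • p i‖ = 1 := by
    have h := norm_sq_sum_smul_of_dist_eq_one hp hb
    rw [hbsq] at h
    exact (sq_eq_sq₀ (norm_nonneg _) zero_le_one).1 (by linarith)
  have hmem : ∑ i, b i • p i ∈ {u : EuclideanSpace ℝ (Fin n) | ‖u‖ = 1} := hu
  refine le_antisymm ?_ (le_csInf (Set.Nonempty.image _ ⟨_, hmem⟩) ?_)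
  · refine (csInf_le ⟨√(2 * ((n : ℝ) + 1) / ((n : ℝ) * ((n : ℝ) + 2))), ?_⟩
      (Set.mem_image_of_mem _ hmem)).trans ?_
    · rintro _ ⟨u, hu, rfl⟩
      exact lower u hu
    · obtain ⟨i, -, hi⟩ := Finset.exists_mem_eq_sup' Finset.univ_nonempty
        (fun k => ⟪∑ i, b i • p i, p k⟫)
      obtain ⟨j, -, hj⟩ := Finset.exists_mem_eq_inf' Finset.univ_nonempty
        (fun k => ⟪∑ i, b i • p i, p k⟫)
      rw [hi, hj, inner_sum_smul_sub_of_dist_eq_one hp hb]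
      have hle : (b i - b j) / 2 ≤ r * (2 * m + 1) / 2 := by
        have : 0 ≤ r * (2 * m + 1) := by positivity
        dsimp only [b]
        split_ifs <;> linarith
      refine hle.trans (Real.le_sqrt_of_sq_le (le_of_eq ?_))
      rw [div_pow, mul_pow, hr, hnm]
      field_simp
  · rintro _ ⟨u, hu, rfl⟩
    exact lower u hu
end
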